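/- arXiv:2309.00185 — 11 statements merged into one kernel-verified Lean document; each statement's English description precedes it below -/
import Mathlib

section
/- Let E be a real Banach space which is finitely isometrically extensible (FIE), and let F be a 1-complemented closed subspace of E. Then F, regarded as a Banach space in its own right, is FIE: for every finite-dimensional subspace W of F and every linear isometric embedding T : W → F there is a bounded linear operator T̃ : F → F with ‖T̃‖ ≤ 1 and T̃|_W = T. -/
noncomputable section

/-- A real normed space `E` is finitely isometrically extensible (FIE) if every linear isometric
embedding of a finite-dimensional subspace of `E` into `E` extends to a bounded linear operator
on `E` of norm at most `1`. -/
def FIE (E : Type*) [NormedAddCommGroup E] [NormedSpace ℝ E] : Prop :=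
  ∀ (X : Subspace ℝ E), FiniteDimensional ℝ X →
    ∀ φ : X →ₗᵢ[ℝ] E, ∃ T : E →L[ℝ] E, ‖T‖ ≤ 1 ∧ ∀ x : X, T x = φ x

/-- A FIE Banach space passes the FIE property to its 1-complemented closed subspaces. -/
theorem fie_of_one_complemented
    (E : Type*) [NormedAddCommGroup E] [NormedSpace ℝ E] [CompleteSpace E]
    (hE : FIE E) (F : Subspace ℝ E) (hFclosed : IsClosed (F : Set E))
    (P : E →L[ℝ] E) (hPrange : Set.range P = (F : Set E))
    (hPidem : ∀ x : E, P (P x) = P x) (hPnorm : ‖P‖ ≤ 1) :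
    FIE F := by
  intro W hW φ
  have hPmem (x : E) : P x ∈ F := by
    rw [← SetLike.mem_coe, ← hPrange]
    exact Set.mem_range_self x
  have hPfix (y : F) : P y = y := by
    obtain ⟨x, hx⟩ : (y : E) ∈ Set.range P := hPrange ▸ y.2
    rw [← hx, hPidem]
  let ψ : W.map F.subtype →ₗᵢ[ℝ] E :=
    { toLinearMap := F.subtype ∘ₗ φ.toLinearMap ∘ₗ (F.equivSubtypeMap W).symm.toLinearMap
      norm_map' := fun x => φ.norm_map ((F.equivSubtypeMap W).symm x) }
  have hψ (w : W) : ψ (F.equivSubtypeMap W w) = φ w :=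
    congrArg (fun v => (φ v : E)) ((F.equivSubtypeMap W).symm_apply_apply w)
  obtain ⟨T, hT, hTψ⟩ := hE (W.map F.subtype) inferInstance ψ
  refine ⟨P.codRestrict F hPmem ∘L T ∘L F.subtypeL, ?_, fun w => Subtype.ext ?_⟩
  · refine ContinuousLinearMap.opNorm_le_bound _ zero_le_one fun x => ?_
    calc ‖P (T x)‖ ≤ 1 * ‖T x‖ := P.le_of_opNorm_le hPnorm _
      _ ≤ 1 * (1 * ‖(x : E)‖) := by gcongr; exact T.le_of_opNorm_le hT _
      _ = 1 * ‖x‖ := by rw [one_mul, Submodule.coe_norm]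
  · change P (T (F.equivSubtypeMap W w)) = φ w
    rw [hTψ, hψ, hPfix]
end
end

section
/- Let E be a real Banach space which is almost finitely isometrically extensible (aFIE), and let F be a 1-complemented closed subspace of E. Then F, regarded as a Banach space in its own right, is aFIE: for every ε > 0, every finite-dimensional subspace Y of F and every linear isometric embedding T : Y → F there is a bounded linear operator T̃ : F → F with ‖T̃‖ ≤ 1 + ε and T̃|_Y = T. -/
noncomputable section

/-- A real normed space `E` is almost finitely isometrically extensible (aFIE) if for every
`ε > 0`, every linear isometric embedding of a finite-dimensional subspace of `E` into `E`
extends to a bounded linear operator on `E` of norm at most `1 + ε`. -/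
def AFIE (E : Type*) [NormedAddCommGroup E] [NormedSpace ℝ E] : Prop :=
  ∀ ε > (0 : ℝ), ∀ (X : Subspace ℝ E), FiniteDimensional ℝ X →
    ∀ φ : X →ₗᵢ[ℝ] E, ∃ T : E →L[ℝ] E, ‖T‖ ≤ 1 + ε ∧ ∀ x : X, T x = φ x

/-- An aFIE Banach space passes the aFIE property to its 1-complemented closed subspaces. -/
theorem afie_of_one_complemented
    (E : Type*) [NormedAddCommGroup E] [NormedSpace ℝ E] [CompleteSpace E]
    (hE : AFIE E) (F : Subspace ℝ E) (hFclosed : IsClosed (F : Set E))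
    (P : E →L[ℝ] E) (hPrange : Set.range P = (F : Set E))
    (hPidem : ∀ x : E, P (P x) = P x) (hPnorm : ‖P‖ ≤ 1) :
    AFIE F := by
  intro ε hε Y hY φ
  have hinj : Function.Injective F.subtype := F.injective_subtype
  let e := (Submodule.equivMapOfInjective F.subtype hinj Y).symm
  have he (x : Y.map F.subtype) : ((e x : F) : E) = x :=
    congrArg Subtype.val ((Submodule.equivMapOfInjective F.subtype hinj Y).apply_symm_apply x)
  let i : Y.map F.subtype →ₗᵢ[ℝ] Y :=
    { e.toLinearMap with norm_map' := fun x => congrArg norm (he x) }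
  obtain ⟨T, hT, hTφ⟩ := hE ε hε (Y.map F.subtype) inferInstance
    (F.subtypeₗᵢ.comp (φ.comp i))
  have hmem (x : E) : P x ∈ F := hPrange.subset (Set.mem_range_self x)
  have hfix (x : F) : P x = x := by
    obtain ⟨z, hz⟩ := hPrange.superset x.2
    rw [← hz, hPidem]
  refine ⟨((P ∘L T) ∘L F.subtypeL).codRestrict F fun x => hmem _, ?_, fun y => ?_⟩
  · refine ContinuousLinearMap.opNorm_le_bound _ (by positivity) fun x => ?_
    calc ‖P (T x)‖ ≤ 1 * ‖T x‖ := P.le_of_opNorm_le hPnorm _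
      _ = ‖T x‖ := one_mul _
      _ ≤ (1 + ε) * ‖x‖ := T.le_of_opNorm_le hT _
  · have hy : T (y : F) = φ y := by
      have h := hTφ (Submodule.equivMapOfInjective F.subtype hinj Y y)
      have hiy : i (Submodule.equivMapOfInjective F.subtype hinj Y y) = y :=
        (Submodule.equivMapOfInjective F.subtype hinj Y).symm_apply_apply y
      simpa [hiy] using h
    apply Subtype.ext
    change P (T (y : F)) = φ y
    rw [hy, hfix]
end
end

section
/- Every reflexive real Banach space (one for which the canonical embedding into the bidual is surjective) which is almost finitely isometrically extensible (aFIE) is finitely isometrically extensible (FIE). -/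
noncomputable section

open NormedSpace

open Filter Topology in
/-- A bounded family of reals converges along every ultrafilter. -/
theorem exists_tendsto_ultrafilter_of_norm_le {ι : Type*} (U : Ultrafilter ι) (u : ι → ℝ) (C : ℝ)
    (hu : ∀ i, ‖u i‖ ≤ C) : ∃ a, Tendsto u U (𝓝 a) := by
  obtain ⟨a, -, ha⟩ := (isCompact_closedBall (0 : ℝ) C).ultrafilter_le_nhds (U.map u)
    (by
      rw [Ultrafilter.coe_map, le_principal_iff, mem_map]
      exact Eventually.of_forall fun i => mem_closedBall_zero_iff.2 (hu i))
  exact ⟨a, ha⟩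

set_option maxSynthPendingDepth 3 in
open Filter Topology in
/-- In a reflexive space, a bounded family of operators whose norm bounds tend to `1` along an
ultrafilter converges along it, in the weak operator topology, to an operator of norm at most `1`. -/
theorem exists_tendsto_weakOperator_of_reflexive {E : Type*} [NormedAddCommGroup E]
    [NormedSpace ℝ E] (hrefl : Function.Surjective (inclusionInDoubleDual ℝ E))
    {ι : Type*} (U : Ultrafilter ι) (c : ι → ℝ) (hc : Tendsto c U (𝓝 1)) (C : ℝ)
    (hcC : ∀ i, c i ≤ C) (S : ι → E →L[ℝ] E) (hS : ∀ i, ‖S i‖ ≤ c i) :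
    ∃ T : E →L[ℝ] E, ‖T‖ ≤ 1 ∧
      ∀ (x : E) (f : StrongDual ℝ E), Tendsto (fun i => f (S i x)) U (𝓝 (f (T x))) := by
  have bound (x : E) (f : StrongDual ℝ E) (i : ι) : ‖f (S i x)‖ ≤ c i * (‖x‖ * ‖f‖) :=
    calc ‖f (S i x)‖ ≤ ‖f‖ * (‖S i‖ * ‖x‖) := f.le_opNorm_of_le ((S i).le_opNorm x)
      _ ≤ ‖f‖ * (c i * ‖x‖) := by gcongr; exact hS i
      _ = c i * (‖x‖ * ‖f‖) := by ring
  have lim (x : E) (f : StrongDual ℝ E) : ∃ a, Tendsto (fun i => f (S i x)) U (𝓝 a) :=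
    exists_tendsto_ultrafilter_of_norm_le U _ (C * (‖x‖ * ‖f‖)) fun i =>
      (bound x f i).trans (by gcongr; exact hcC i)
  choose B hB using lim
  let A : E →L[ℝ] StrongDual ℝ E →L[ℝ] ℝ := LinearMap.mkContinuous₂
    (LinearMap.mk₂ ℝ B
      (fun x y f => tendsto_nhds_unique (hB (x + y) f) (by simpa using (hB x f).add (hB y f)))
      (fun r x f => tendsto_nhds_unique (hB (r • x) f) (by simpa using (hB x f).const_mul r))
      (fun x f g => tendsto_nhds_unique (hB x (f + g)) (by simpa using (hB x f).add (hB x g)))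
      (fun r x f => tendsto_nhds_unique (hB x (r • f)) (by simpa using (hB x f).const_mul r)))
    1 (fun x f => by
      rw [mul_assoc]
      exact le_of_tendsto_of_tendsto' (hB x f).norm (hc.mul_const _) (bound x f))
  have hA : ‖A‖ ≤ 1 := LinearMap.mkContinuous₂_norm_le _ zero_le_one _
  let J := LinearIsometryEquiv.ofSurjective (inclusionInDoubleDualLi (𝕜 := ℝ) (E := E)) hrefl
  refine ⟨(J.symm : _ →L[ℝ] E).comp A, ?_, fun x f => ?_⟩
  · refine ContinuousLinearMap.opNorm_le_bound _ zero_le_one fun x => ?_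
    simpa using A.le_of_opNorm_le hA x
  · have h : f (J.symm (A x)) = B x f :=
      DFunLike.congr_fun (J.apply_symm_apply (A x)) f
    exact h.symm ▸ hB x f

/-- Every reflexive real Banach space which is aFIE is FIE. -/
theorem fie_of_afie_reflexive
    (E : Type*) [NormedAddCommGroup E] [NormedSpace ℝ E] [CompleteSpace E]
    (hrefl : Function.Surjective (inclusionInDoubleDual ℝ E))
    (hE : AFIE E) :
    FIE E := by
  intro X hX φ
  have hpos (n : ℕ) : (0 : ℝ) < 1 / ((n : ℝ) + 1) := Nat.one_div_pos_of_nat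
  choose S hS hSφ using fun n : ℕ => hE _ (hpos n) X hX φ
  obtain ⟨T, hT, hlim⟩ := exists_tendsto_weakOperator_of_reflexive hrefl
    (Filter.hyperfilter ℕ) (fun n : ℕ => 1 + 1 / ((n : ℝ) + 1))
    (by
      simpa using ((tendsto_one_div_add_atTop_nhds_zero_nat (𝕜 := ℝ)).mono_left
        Nat.hyperfilter_le_atTop).const_add 1)
    2 (fun n => by
      have : 1 / ((n : ℝ) + 1) ≤ 1 := (div_le_one (by positivity)).2 (by simp)
      linarith) S hS
  refine ⟨T, hT, fun x => (SeparatingDual.eq_iff_forall_dual_eq (R := ℝ)).2 fun f => ?_⟩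
  refine tendsto_nhds_unique (hlim x f) ?_
  simp [hSφ]
end
end

section
/- Every approximately ultrahomogeneous (AUH) real Banach space is almost ultrahomogeneous: if E is AUH, then for every ε > 0, every finite-dimensional subspace X of E and every linear isometric embedding φ : X → E there is a surjective ε-isometry T of E with T|_X = φ. -/
noncomputable section

/-- `T` is a surjective `ε`-isometry of `E`: a linear bijection with
`(1+ε)⁻¹‖z‖ ≤ ‖Tz‖ ≤ (1+ε)‖z‖` for all `z`. -/
def IsEpsIsom {E : Type*} [NormedAddCommGroup E] [NormedSpace ℝ E]
    (ε : ℝ) (T : E ≃L[ℝ] E) : Prop :=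
  ∀ z : E, (1 + ε)⁻¹ * ‖z‖ ≤ ‖T z‖ ∧ ‖T z‖ ≤ (1 + ε) * ‖z‖

/-- A real normed space `E` is approximately ultrahomogeneous (AUH) if for every
finite-dimensional subspace `X` of `E`, every `ε > 0` and all linear isometric embeddings
`φ, ψ : X → E` there is a surjective linear isometry `T` of `E` with `‖T∘φ − ψ‖ < ε`. -/
def AUH (E : Type*) [NormedAddCommGroup E] [NormedSpace ℝ E] : Prop :=
  ∀ (X : Subspace ℝ E), FiniteDimensional ℝ X → ∀ ε > (0 : ℝ),
    ∀ φ ψ : X →ₗᵢ[ℝ] E, ∃ T : E ≃ₗᵢ[ℝ] E,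
      ‖T.toLinearIsometry.toContinuousLinearMap.comp φ.toContinuousLinearMap
        - ψ.toContinuousLinearMap‖ < ε

/-- Every approximately ultrahomogeneous real Banach space is almost ultrahomogeneous. -/
theorem almostUH_of_AUH
    (E : Type*) [NormedAddCommGroup E] [NormedSpace ℝ E] [CompleteSpace E]
    (hE : AUH E) :
    ∀ ε > (0 : ℝ), ∀ (X : Subspace ℝ E), FiniteDimensional ℝ X →
      ∀ φ : X →ₗᵢ[ℝ] E, ∃ T : E ≃L[ℝ] E, IsEpsIsom ε T ∧ ∀ x : X, T (x : E) = φ x := by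
  intro ε hε X hX φ
  obtain ⟨P, hP⟩ := Submodule.ClosedComplemented.of_finiteDimensional X
  set c : ℝ := ε / (1 + ε) with hc
  have hc0 : 0 < c := by positivity
  have hc1 : 1 - c = (1 + ε)⁻¹ := by rw [hc]; field_simp; ring
  have hcε : c ≤ ε := div_le_self hε.le (by linarith)
  have hclt : c < 1 := by
    have : 0 < (1 + ε)⁻¹ := by positivity
    linarith
  obtain ⟨S, hS⟩ := hE X hX (c / (‖P‖ + 1)) (by positivity) X.subtypeₗᵢ φ
  set D : X →L[ℝ] E := S.toLinearIsometry.toContinuousLinearMap.comp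
    X.subtypeₗᵢ.toContinuousLinearMap - φ.toContinuousLinearMap with hD
  let R : E →L[ℝ] E := S.symm.toLinearIsometry.toContinuousLinearMap.comp (D.comp P)
  have hRz (z : E) : ‖R z‖ ≤ c * ‖z‖ := by
    calc ‖R z‖ = ‖D (P z)‖ := S.symm.norm_map _
      _ ≤ ‖D‖ * (‖P‖ * ‖z‖) := D.le_opNorm_of_le (P.le_opNorm z)
      _ ≤ c / (‖P‖ + 1) * ((‖P‖ + 1) * ‖z‖) := by gcongr; linarith
      _ = c * ‖z‖ := by field_simp
  have hR : ‖R‖ < 1 := (R.opNorm_le_bound hc0.le hRz).trans_lt hclt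
  let T : E ≃L[ℝ] E :=
    (ContinuousLinearEquiv.ofUnit (Units.oneSub R hR)).trans S.toContinuousLinearEquiv
  have hT (z : E) : T z = S (z - R z) := rfl
  refine ⟨T, fun z => ?_, fun x => ?_⟩
  · rw [hT, S.norm_map, ← hc1]
    have h₁ := norm_sub_norm_le z (R z)
    have h₂ := norm_sub_le z (R z)
    have h₃ := hRz z
    have h₄ := mul_le_mul_of_nonneg_right hcε (norm_nonneg z)
    constructor <;> linarith
  · have hSR : S (R x) = S x - φ x := by
      change S (S.symm (D (P x))) = _
      rw [S.apply_symm_apply, hP]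
      rfl
    rw [hT, map_sub, hSR, sub_sub_cancel]
end
end

section
/- For a real Banach space E the following two conditions are equivalent: (i) for every finite-dimensional subspace X of E and every ε > 0 there is δ > 0 such that for all φ₁, φ₂ ∈ Emb_δ(X,E) there is T ∈ Isom_ε(E) with T∘φ₁ = φ₂; (ii) for every finite-dimensional subspace X of E and every ε > 0 there is δ > 0 such that for every φ ∈ Emb_δ(X,E) there is T ∈ Isom_ε(E) with T|_X = φ. -/
noncomputable section

/-- `φ` is a `δ`-isometry (a member of `Emb_δ(X,E)`). -/
def IsEmb {E X : Type*} [NormedAddCommGroup E] [NormedSpace ℝ E]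
    [NormedAddCommGroup X] [NormedSpace ℝ X] (δ : ℝ) (φ : X →L[ℝ] E) : Prop :=
  ∀ x : X, (1 + δ)⁻¹ * ‖x‖ ≤ ‖φ x‖ ∧ ‖φ x‖ ≤ (1 + δ) * ‖x‖

theorem isEmb_subtypeL {E : Type*} [NormedAddCommGroup E] [NormedSpace ℝ E]
    (X : Subspace ℝ E) {δ : ℝ} (hδ : 0 ≤ δ) : IsEmb δ (Submodule.subtypeL X) := by
  intro x
  have h : (1 + δ)⁻¹ ≤ 1 := inv_le_one_of_one_le₀ (by linarith)
  have hx : ‖X.subtypeL x‖ = ‖x‖ := rfl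
  rw [hx]
  exact ⟨mul_le_of_le_one_left (norm_nonneg x) h,
    le_mul_of_one_le_left (norm_nonneg x) (by linarith)⟩

theorem IsEpsIsom.symm {E : Type*} [NormedAddCommGroup E] [NormedSpace ℝ E]
    {ε : ℝ} (hε : 0 ≤ ε) {T : E ≃L[ℝ] E} (hT : IsEpsIsom ε T) : IsEpsIsom ε T.symm := by
  intro z
  have h := hT (T.symm z)
  rw [T.apply_symm_apply] at h
  have hpos : 0 < 1 + ε := by linarith
  exact ⟨(inv_mul_le_iff₀ hpos).2 h.2, (inv_mul_le_iff₀ hpos).1 h.1⟩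

theorem IsEpsIsom.trans {E : Type*} [NormedAddCommGroup E] [NormedSpace ℝ E]
    {ε₁ ε₂ ε : ℝ} (hε₂ : 0 ≤ ε₂) (hε : (1 + ε₂) * (1 + ε₁) = 1 + ε)
    {S T : E ≃L[ℝ] E} (hS : IsEpsIsom ε₁ S) (hT : IsEpsIsom ε₂ T) :
    IsEpsIsom ε (S.trans T) := by
  intro z
  rw [← hε, mul_inv, mul_assoc, mul_assoc, ContinuousLinearEquiv.trans_apply]
  have hpos : 0 ≤ 1 + ε₂ := by linarith
  exact ⟨(mul_le_mul_of_nonneg_left (hS z).1 (inv_nonneg.2 hpos)).trans (hT (S z)).1,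
    (hT (S z)).2.trans (mul_le_mul_of_nonneg_left (hS z).2 hpos)⟩

/-- Equivalence of the two forms of the weak almost Fraïssé property. -/
theorem weak_af_two_embeddings_iff_extension
    (E : Type*) [NormedAddCommGroup E] [NormedSpace ℝ E] [CompleteSpace E] :
    (∀ (X : Subspace ℝ E), FiniteDimensional ℝ X → ∀ ε > (0 : ℝ), ∃ δ > (0 : ℝ),
        ∀ φ₁ φ₂ : X →L[ℝ] E, IsEmb δ φ₁ → IsEmb δ φ₂ →
          ∃ T : E ≃L[ℝ] E, IsEpsIsom ε T ∧ ∀ x : X, T (φ₁ x) = φ₂ x) ↔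
    (∀ (X : Subspace ℝ E), FiniteDimensional ℝ X → ∀ ε > (0 : ℝ), ∃ δ > (0 : ℝ),
        ∀ φ : X →L[ℝ] E, IsEmb δ φ →
          ∃ T : E ≃L[ℝ] E, IsEpsIsom ε T ∧ ∀ x : X, T (x : E) = φ x) := by
  constructor
  · intro h X hX ε hε
    obtain ⟨δ, hδ, H⟩ := h X hX ε hε
    exact ⟨δ, hδ, fun φ hφ => H X.subtypeL φ (isEmb_subtypeL X hδ.le) hφ⟩
  · intro h X hX ε hε
    have hη : 0 < √(1 + ε) - 1 := by
      rw [sub_pos, Real.lt_sqrt zero_le_one]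
      linarith
    obtain ⟨δ, hδ, H⟩ := h X hX (√(1 + ε) - 1) hη
    refine ⟨δ, hδ, fun φ₁ φ₂ h₁ h₂ => ?_⟩
    obtain ⟨T₁, hT₁, e₁⟩ := H φ₁ h₁
    obtain ⟨T₂, hT₂, e₂⟩ := H φ₂ h₂
    refine ⟨T₁.symm.trans T₂, (hT₁.symm hη.le).trans hη.le ?_ hT₂, fun x => ?_⟩
    · rw [add_sub_cancel, Real.mul_self_sqrt (by linarith)]
    · rw [ContinuousLinearEquiv.trans_apply, ← e₁ x, T₁.symm_apply_apply, e₂ x]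
end
end

section
/- Every Fraïssé real Banach space is almost Fraïssé (AF): if E is Fraïssé, then for every ε > 0 and every k ∈ ℕ there is δ > 0 such that for every k-dimensional subspace X of E and every φ ∈ Emb_δ(X,E) there is T ∈ Isom_ε(E) with T|_X = φ. -/
noncomputable section

open Module

/-- `E` is Fraïssé: for every `ε > 0` and every `k` there is `δ > 0` such that for every
`k`-dimensional subspace `X` and all `φ, ψ ∈ Emb_δ(X,E)` there is a surjective linear isometry
`T` with `‖T∘φ − ψ‖ < ε`. -/
def Fraisse (E : Type*) [NormedAddCommGroup E] [NormedSpace ℝ E] : Prop :=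
  ∀ ε > (0 : ℝ), ∀ k : ℕ, ∃ δ > (0 : ℝ), ∀ (X : Subspace ℝ E),
    FiniteDimensional ℝ X → finrank ℝ X = k →
    ∀ φ ψ : X →L[ℝ] E, IsEmb δ φ → IsEmb δ ψ →
      ∃ T : E ≃ₗᵢ[ℝ] E, ‖T.toLinearIsometry.toContinuousLinearMap.comp φ - ψ‖ < ε

/-- `E` is almost Fraïssé (AF): for every `ε > 0` and every `k` there is `δ > 0` such that every
`δ`-embedding of a `k`-dimensional subspace extends to a surjective `ε`-isometry of `E`. -/
def AlmostFraisse (E : Type*) [NormedAddCommGroup E] [NormedSpace ℝ E] : Prop :=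
  ∀ ε > (0 : ℝ), ∀ k : ℕ, ∃ δ > (0 : ℝ), ∀ (X : Subspace ℝ E),
    FiniteDimensional ℝ X → finrank ℝ X = k →
    ∀ φ : X →L[ℝ] E, IsEmb δ φ →
      ∃ T : E ≃L[ℝ] E, IsEpsIsom ε T ∧ ∀ x : X, T (x : E) = φ x

/-- Subspaces of dimension at most `k` are complemented by projections whose norms are bounded in
terms of `k` only. -/
theorem exists_bounded_projection (E : Type*) [NormedAddCommGroup E] [NormedSpace ℝ E] (k : ℕ) :
    ∃ C > (0 : ℝ), ∀ X : Subspace ℝ E, FiniteDimensional ℝ X → finrank ℝ X ≤ k →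
      ∃ P : E →L[ℝ] E, (∀ z, P z ∈ X) ∧ (∀ x ∈ X, P x = x) ∧ ∀ z, ‖P z‖ ≤ C * ‖z‖ := by
  induction k with
  | zero =>
    refine ⟨1, one_pos, fun X _ hk => ⟨0, fun z => X.zero_mem, fun x hx => ?_, fun z => ?_⟩⟩
    · rw [Submodule.finrank_eq_zero.1 (Nat.le_zero.1 hk), Submodule.mem_bot] at hx
      simp [hx]
    · simp
  | succ k ih =>
    obtain ⟨C, hC, ih⟩ := ih
    refine ⟨1 + 2 * C, by positivity, fun X _ hk => ?_⟩
    rcases eq_or_ne X ⊥ with rfl | hX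
    · refine ⟨0, fun z => Submodule.zero_mem _, fun x hx => ?_, fun z => ?_⟩
      · simp [(Submodule.mem_bot ℝ).1 hx]
      · simp only [zero_apply, norm_zero]
        positivity
    obtain ⟨y, hyX, hy⟩ := Submodule.exists_mem_ne_zero_of_ne_bot hX
    obtain ⟨f, hf, hfy⟩ := exists_dual_vector ℝ y (norm_ne_zero_iff.2 hy)
    have hfy' : f y = ‖y‖ := by simpa using hfy
    have hy0 : ‖y‖ ≠ 0 := norm_ne_zero_iff.2 hy
    set x : E := ‖y‖⁻¹ • y with hx
    have hxX : x ∈ X := X.smul_mem _ hyX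
    have hx1 : ‖x‖ = 1 := by rw [hx, norm_smul, norm_inv, norm_norm, inv_mul_cancel₀ hy0]
    have hfx : f x = 1 := by rw [hx, map_smul, hfy', smul_eq_mul, inv_mul_cancel₀ hy0]
    have hlt : X ⊓ LinearMap.ker (f : E →ₗ[ℝ] ℝ) < X := by
      refine lt_of_le_of_ne inf_le_left fun h => ?_
      have h0 : f x = 0 := (h.ge hxX).2
      exact one_ne_zero (hfx.symm.trans h0)
    have hfin := Submodule.finrank_lt_finrank_of_lt hlt
    obtain ⟨Q, hQmem, hQid, hQ⟩ := ih (X ⊓ LinearMap.ker (f : E →ₗ[ℝ] ℝ))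
      (Submodule.finiteDimensional_of_le inf_le_left) (by omega)
    have hfz : ∀ z, ‖f z • x‖ ≤ ‖z‖ := fun z => by
      rw [norm_smul, hx1, mul_one]
      simpa [hf] using f.le_opNorm z
    refine ⟨f.smulRight x + Q.comp (ContinuousLinearMap.id ℝ E - f.smulRight x),
      fun z => ?_, fun z hz => ?_, fun z => ?_⟩
    · exact X.add_mem (X.smul_mem _ hxX) (hQmem _).1
    · have hmem : z - f z • x ∈ X ⊓ LinearMap.ker (f : E →ₗ[ℝ] ℝ) :=
        ⟨X.sub_mem hz (X.smul_mem _ hxX), by simp [hfx]⟩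
      change f z • x + Q (z - f z • x) = z
      rw [hQid _ hmem, add_sub_cancel]
    · change ‖f z • x + Q (z - f z • x)‖ ≤ _
      have h1 := norm_add_le (f z • x) (Q (z - f z • x))
      have h2 := hQ (z - f z • x)
      have h3 := norm_sub_le z (f z • x)
      have h4 := mul_le_mul_of_nonneg_left (h3.trans (add_le_add_right (hfz z) _)) hC.le
      linarith [hfz z]

/-- Every Fraïssé real Banach space is almost Fraïssé. -/
theorem almostFraisse_of_fraisse
    (E : Type*) [NormedAddCommGroup E] [NormedSpace ℝ E] [CompleteSpace E]
    (hE : Fraisse E) : AlmostFraisse E := by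
  intro ε hε k
  obtain ⟨C, hC, hproj⟩ := exists_bounded_projection E k
  obtain ⟨δ, hδ, hF⟩ := hE (ε / (1 + ε) / C) (by positivity) k
  refine ⟨δ, hδ, fun X hX hk φ hφ => ?_⟩
  have hincl : IsEmb δ X.subtypeL := fun x => by
    have hx := norm_nonneg x
    refine ⟨mul_le_of_le_one_left hx (inv_le_one_of_one_le₀ (by linarith)), ?_⟩
    exact le_mul_of_one_le_left hx (by linarith)
  obtain ⟨T, hT⟩ := hF X hX hk X.subtypeL φ hincl hφ
  obtain ⟨P, hPmem, hPid, hP⟩ := hproj X hX hk.le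
  set D : X →L[ℝ] E := T.toLinearIsometry.toContinuousLinearMap.comp X.subtypeL - φ with hD
  set A : E →L[ℝ] E :=
    T.symm.toLinearIsometry.toContinuousLinearMap.comp (D.comp (P.codRestrict X hPmem)) with hA
  have hTA : ∀ z, T (A z) = D ⟨P z, hPmem z⟩ := fun z => T.apply_symm_apply _
  have hDC : ‖D‖ * C < ε / (1 + ε) := (lt_div_iff₀ hC).1 hT
  have hAz : ∀ z, ‖A z‖ ≤ ‖D‖ * C * ‖z‖ := fun z => by
    rw [← T.norm_map, hTA, mul_assoc]
    exact (D.le_opNorm _).trans (mul_le_mul_of_nonneg_left (hP z) (norm_nonneg D))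
  have hA1 : ‖A‖ < 1 :=
    (A.opNorm_le_bound (by positivity) hAz).trans_lt
      (hDC.trans ((div_lt_one (by positivity)).2 (by linarith)))
  let U : E ≃L[ℝ] E := ContinuousLinearEquiv.ofUnit (Units.oneSub A hA1)
  have hU : ∀ z, U z = z - A z := fun z => rfl
  refine ⟨U.trans T.toContinuousLinearEquiv, fun z => ?_, fun x => ?_⟩
  · have hnorm : ‖(U.trans T.toContinuousLinearEquiv) z‖ = ‖z - A z‖ := by
      rw [← hU]
      exact T.norm_map _
    have hAε : ‖A z‖ ≤ ε / (1 + ε) * ‖z‖ :=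
      (hAz z).trans (mul_le_mul_of_nonneg_right hDC.le (norm_nonneg z))
    have hinv : (1 + ε)⁻¹ = 1 - ε / (1 + ε) := by
      field_simp
      ring
    have hle : ε / (1 + ε) * ‖z‖ ≤ ε * ‖z‖ :=
      mul_le_mul_of_nonneg_right (div_le_self hε.le (by linarith)) (norm_nonneg z)
    rw [hnorm, hinv]
    constructor
    · linarith [norm_sub_norm_le z (A z)]
    · linarith [norm_sub_le z (A z)]
  · change T (U x) = φ x
    have hPx : (⟨P x, hPmem x⟩ : X) = x := Subtype.ext (hPid x x.2)
    rw [hU, map_sub, hTA, hPx]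
    exact sub_sub_cancel (T (x : E)) (φ x)
end
end

section
/- Every weak Fraïssé real Banach space is weak almost Fraïssé (weak AF): if E is weak Fraïssé, then for every finite-dimensional subspace X of E and every ε > 0 there is δ > 0 such that for every φ ∈ Emb_δ(X,E) there is T ∈ Isom_ε(E) with T|_X = φ. -/
noncomputable section

/-- `E` is weak Fraïssé: for every finite-dimensional subspace `X` and every `ε > 0` there is
`δ > 0` such that for all `φ, ψ ∈ Emb_δ(X,E)` there is a surjective linear isometry `T` with
`‖T∘φ − ψ‖ < ε`. -/
def WeakFraisse (E : Type*) [NormedAddCommGroup E] [NormedSpace ℝ E] : Prop :=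
  ∀ (X : Subspace ℝ E), FiniteDimensional ℝ X → ∀ ε > (0 : ℝ), ∃ δ > (0 : ℝ),
    ∀ φ ψ : X →L[ℝ] E, IsEmb δ φ → IsEmb δ ψ →
      ∃ T : E ≃ₗᵢ[ℝ] E, ‖T.toLinearIsometry.toContinuousLinearMap.comp φ - ψ‖ < ε

/-- `E` is weak almost Fraïssé (weak AF). -/
def WeakAlmostFraisse (E : Type*) [NormedAddCommGroup E] [NormedSpace ℝ E] : Prop :=
  ∀ (X : Subspace ℝ E), FiniteDimensional ℝ X → ∀ ε > (0 : ℝ), ∃ δ > (0 : ℝ),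
    ∀ φ : X →L[ℝ] E, IsEmb δ φ →
      ∃ T : E ≃L[ℝ] E, IsEpsIsom ε T ∧ ∀ x : X, T (x : E) = φ x

/-- A small perturbation of a surjective linear isometry of a Banach space is an
isomorphism of the space. -/
theorem exists_continuousLinearEquiv_eq_isometry_sub {E : Type*} [NormedAddCommGroup E]
    [NormedSpace ℝ E] [CompleteSpace E] (T : E ≃ₗᵢ[ℝ] E) (R : E →L[ℝ] E) (hR : ‖R‖ < 1) :
    ∃ S : E ≃L[ℝ] E, ∀ z, S z = T z - R z := by
  let A : E →L[ℝ] E := T.symm.toLinearIsometry.toContinuousLinearMap.comp R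
  have hA : ‖A‖ < 1 := by
    refine lt_of_le_of_lt (A.opNorm_le_bound (norm_nonneg R) fun z ↦ ?_) hR
    simpa [A] using R.le_opNorm z
  refine ⟨(ContinuousLinearEquiv.ofUnit (Units.oneSub A hA)).trans T.toContinuousLinearEquiv,
    fun z ↦ ?_⟩
  change T ((1 - A) z) = _
  simp [A]

/-- A map within `η` of an isometry distorts norms by at most `1 ± η`, hence is an `ε`-isometry
when `η = ε / (1 + ε)`. -/
theorem isEpsIsom_of_norm_sub_le {E : Type*} [NormedAddCommGroup E] [NormedSpace ℝ E]
    {ε : ℝ} (hε : 0 < ε) (T : E ≃ₗᵢ[ℝ] E) (S : E ≃L[ℝ] E)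
    (h : ∀ z, ‖T z - S z‖ ≤ ε / (1 + ε) * ‖z‖) : IsEpsIsom ε S := by
  intro z
  have hlow : ‖T z‖ - ‖S z‖ ≤ ‖T z - S z‖ := norm_sub_norm_le _ _
  have hup : ‖S z‖ - ‖T z‖ ≤ ‖T z - S z‖ := norm_sub_rev (T z) (S z) ▸ norm_sub_norm_le _ _
  rw [T.norm_map] at hlow hup
  have hz := h z
  have hη : (1 + ε)⁻¹ = 1 - ε / (1 + ε) := by field_simp; ring
  have hηε : ε / (1 + ε) ≤ ε := div_le_self hε.le (by linarith)
  constructor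
  · rw [hη]
    linarith
  · linarith [mul_le_mul_of_nonneg_right hηε (norm_nonneg z)]

/-- Every weak Fraïssé real Banach space is weak almost Fraïssé. -/
theorem weakAlmostFraisse_of_weakFraisse
    (E : Type*) [NormedAddCommGroup E] [NormedSpace ℝ E] [CompleteSpace E]
    (hE : WeakFraisse E) : WeakAlmostFraisse E := by
  intro X hX ε hε
  obtain ⟨P, hP⟩ := Submodule.ClosedComplemented.of_finiteDimensional X
  have hη : 0 < ε / (1 + ε) := by positivity
  have hη1 : ε / (1 + ε) < 1 := (div_lt_one (by linarith)).2 (by linarith)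
  have hP1 : 0 < ‖P‖ + 1 := by positivity
  obtain ⟨δ, hδ, h⟩ := hE X hX (ε / (1 + ε) / (‖P‖ + 1)) (by positivity)
  refine ⟨δ, hδ, fun φ hφ ↦ ?_⟩
  have hincl : IsEmb δ X.subtypeL := fun x ↦
    ⟨mul_le_of_le_one_left (norm_nonneg x) (inv_le_one_of_one_le₀ (by linarith)),
      le_mul_of_one_le_left (norm_nonneg x) (by linarith)⟩
  obtain ⟨T, hT⟩ := h _ φ hincl hφ
  set D := T.toLinearIsometry.toContinuousLinearMap.comp X.subtypeL - φ with hD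
  have hR : ‖D.comp P‖ ≤ ε / (1 + ε) := by
    calc ‖D.comp P‖ ≤ ‖D‖ * ‖P‖ := D.opNorm_comp_le P
      _ ≤ ε / (1 + ε) / (‖P‖ + 1) * (‖P‖ + 1) := by gcongr; linarith
      _ = ε / (1 + ε) := div_mul_cancel₀ _ hP1.ne'
  obtain ⟨S, hS⟩ := exists_continuousLinearEquiv_eq_isometry_sub T (D.comp P) (hR.trans_lt hη1)
  refine ⟨S, isEpsIsom_of_norm_sub_le hε T S fun z ↦ ?_, fun x ↦ ?_⟩
  · rw [hS, sub_sub_cancel]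
    exact (D.comp P).le_of_opNorm_le hR z
  · simp [hS, hD, hP]
end
end

section
/- The almost Fraïssé property is preserved by almost isometries: if E and F are real Banach spaces such that for every ξ > 0 there exists a surjective ξ-isometry j : E → F, and E is almost Fraïssé (AF), then F is almost Fraïssé. -/
noncomputable section

open Module

namespace IsEmb

variable {X Y Z : Type*} [NormedAddCommGroup X] [NormedSpace ℝ X]
  [NormedAddCommGroup Y] [NormedSpace ℝ Y] [NormedAddCommGroup Z] [NormedSpace ℝ Z]

theorem mono {a b : ℝ} (ha : 0 ≤ a) (hab : a ≤ b) {f : X →L[ℝ] Y} (hf : IsEmb a f) :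
    IsEmb b f := by
  intro x
  obtain ⟨hl, hu⟩ := hf x
  exact ⟨le_trans (by gcongr) hl, hu.trans (by gcongr)⟩

theorem comp {a b c : ℝ} (ha : 0 ≤ a) (hb : 0 ≤ b) (hc : (1 + a) * (1 + b) ≤ 1 + c)
    {g : Y →L[ℝ] Z} {f : X →L[ℝ] Y} (hg : IsEmb a g) (hf : IsEmb b f) :
    IsEmb c (g.comp f) := by
  intro x
  obtain ⟨hfl, hfu⟩ := hf x
  obtain ⟨hgl, hgu⟩ := hg (f x)
  constructor
  · calc (1 + c)⁻¹ * ‖x‖ ≤ ((1 + a) * (1 + b))⁻¹ * ‖x‖ := by gcongr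
      _ = (1 + a)⁻¹ * ((1 + b)⁻¹ * ‖x‖) := by rw [mul_inv, mul_assoc]
      _ ≤ (1 + a)⁻¹ * ‖f x‖ := by gcongr
      _ ≤ ‖g.comp f x‖ := hgl
  · calc ‖g.comp f x‖ ≤ (1 + a) * ‖f x‖ := hgu
      _ ≤ (1 + a) * ((1 + b) * ‖x‖) := by gcongr
      _ = (1 + a) * (1 + b) * ‖x‖ := by rw [mul_assoc]
      _ ≤ (1 + c) * ‖x‖ := by gcongr

theorem conj {W : Type*} [NormedAddCommGroup W] [NormedSpace ℝ W] {a c : ℝ} (ha : 0 ≤ a)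
    (hc : (1 + a) ^ 3 ≤ 1 + c) {h : Z →L[ℝ] W} {g : Y →L[ℝ] Z} {f : X →L[ℝ] Y}
    (hh : IsEmb a h) (hg : IsEmb a g) (hf : IsEmb a f) :
    IsEmb c (h.comp (g.comp f)) :=
  hh.comp (b := (1 + a) * (1 + a) - 1) ha (by nlinarith) (by linarith)
    (hg.comp ha ha (by linarith) hf)

theorem symm {a : ℝ} (ha : 0 ≤ a) {e : X ≃L[ℝ] Y} (he : IsEmb a (e : X →L[ℝ] Y)) :
    IsEmb a (e.symm : Y →L[ℝ] X) := by
  intro y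
  obtain ⟨hl, hu⟩ := he (e.symm y)
  simp only [ContinuousLinearEquiv.coe_coe, ContinuousLinearEquiv.apply_symm_apply] at hl hu ⊢
  have h : 0 < 1 + a := by positivity
  exact ⟨(inv_mul_le_iff₀ h).2 hu, (inv_mul_le_iff₀ h).1 hl⟩

theorem injective {a : ℝ} (ha : 0 ≤ a) {f : X →L[ℝ] Y} (hf : IsEmb a f) :
    Function.Injective f := by
  refine (injective_iff_map_eq_zero f).2 fun x hx => ?_
  have hl := (hf x).1
  rw [hx, norm_zero, inv_mul_le_iff₀ (by positivity), mul_zero] at hl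
  exact norm_le_zero_iff.1 hl

end IsEmb

theorem exists_pos_one_add_pow_three_le {ε : ℝ} (hε : 0 < ε) :
    ∃ a > 0, (1 + a) ^ 3 ≤ 1 + ε := by
  refine ⟨min 1 ε / 7, by positivity, ?_⟩
  have h₁ := min_le_left 1 ε
  have h₂ := min_le_right 1 ε
  have h₀ : 0 < min 1 ε := by positivity
  nlinarith [mul_le_mul_of_nonneg_left h₁ h₀.le,
    mul_le_mul_of_nonneg_left h₁ (mul_pos h₀ h₀).le]

/-- The almost Fraïssé property is preserved by almost isometries: if for every `ξ > 0` there is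
a surjective `ξ`-isometry from `E` onto `F` and `E` is AF, then `F` is AF. -/
theorem almostFraisse_of_almostIsometric
    (E F : Type*) [NormedAddCommGroup E] [NormedSpace ℝ E] [CompleteSpace E]
    [NormedAddCommGroup F] [NormedSpace ℝ F] [CompleteSpace F]
    (hiso : ∀ ξ > (0 : ℝ), ∃ j : E →L[ℝ] F, Function.Surjective j ∧
      ∀ x : E, (1 + ξ)⁻¹ * ‖x‖ ≤ ‖j x‖ ∧ ‖j x‖ ≤ (1 + ξ) * ‖x‖)
    (hE : AlmostFraisse E) : AlmostFraisse F := by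
  intro ε hε k
  obtain ⟨η, hη, hηε⟩ := exists_pos_one_add_pow_three_le hε
  obtain ⟨δ, hδ, H⟩ := hE η hη k
  obtain ⟨a, ha, haδ⟩ := exists_pos_one_add_pow_three_le hδ
  set ξ := min η a
  have hξ : 0 < ξ := lt_min hη ha
  have hξη : ξ ≤ η := min_le_left _ _
  have hξδ : (1 + ξ) ^ 3 ≤ 1 + δ :=
    le_trans (by have : ξ ≤ a := min_le_right _ _; gcongr) haδ
  obtain ⟨j₀, hsurj, hj₀⟩ := hiso ξ hξ
  have hinj : Function.Injective j₀ := IsEmb.injective hξ.le hj₀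
  obtain ⟨j, hj⟩ : ∃ j : E ≃L[ℝ] F, IsEmb ξ (j : E →L[ℝ] F) :=
    ⟨ContinuousLinearEquiv.ofBijective j₀
      (LinearMap.ker_eq_bot.2 hinj) (LinearMap.range_eq_top.2 hsurj), hj₀⟩
  have hj' := hj.symm hξ.le
  refine ⟨ξ, hξ, fun X hX hk φ hφ => ?_⟩
  obtain ⟨Y, e, he⟩ : ∃ (Y : Subspace ℝ E) (e : X ≃L[ℝ] Y), ∀ x, (e x : E) = j.symm x :=
    ⟨_, j.symm.submoduleMap X, fun _ => rfl⟩
  have he' : IsEmb ξ (e : X →L[ℝ] Y) := fun x => by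
    have h := hj' x
    rw [ContinuousLinearEquiv.coe_coe, ← he] at h
    exact h
  obtain ⟨T, hT, hTφ⟩ := H Y e.toLinearEquiv.finiteDimensional
    (e.toLinearEquiv.finrank_eq.symm.trans hk)
    ((j.symm : F →L[ℝ] E).comp (φ.comp (e.symm : Y →L[ℝ] X)))
    (hj'.conj hξ.le hξδ hφ (he'.symm hξ.le))
  refine ⟨(j.symm.trans T).trans j, ?_, fun x => ?_⟩
  · exact IsEmb.conj (g := (T : E →L[ℝ] E)) hη.le hηε (hj.mono hξ.le hξη) hT
      (hj'.mono hξ.le hξη)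
  · have h := hTφ (e x)
    rw [he] at h
    simp [h]
end
end

section
/- Let E be a real Banach space, k ∈ ℕ, and let (X_n) be a sequence of k-dimensional linear subspaces of E such that the closed unit balls B_{X_n} (viewed as subsets of E) converge in the Hausdorff distance to a nonempty compact set A ⊆ E. Then there exists a k-dimensional linear subspace X₀ of E such that A is the closed unit ball of X₀. -/
noncomputable section

open Module

section LimitSubspace

open Filter Topology

variable {E : Type*} [NormedAddCommGroup E] [NormedSpace ℝ E]

/-- The subspace of all limits of convergent sequences whose `n`-th term lies in `X n`. -/
def limitSubspace (X : ℕ → Subspace ℝ E) : Subspace ℝ E where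
  carrier := {x | ∃ u : ℕ → E, (∀ n, u n ∈ X n) ∧ Tendsto u atTop (𝓝 x)}
  add_mem' := by
    rintro x y ⟨u, hu, hux⟩ ⟨v, hv, hvy⟩
    exact ⟨fun n => u n + v n, fun n => (X n).add_mem (hu n) (hv n), hux.add hvy⟩
  zero_mem' := ⟨fun _ => 0, fun n => (X n).zero_mem, tendsto_const_nhds⟩
  smul_mem' := by
    rintro c x ⟨u, hu, hux⟩
    exact ⟨fun n => c • u n, fun n => (X n).smul_mem c (hu n), hux.const_smul c⟩

theorem mem_limitSubspace {X : ℕ → Subspace ℝ E} {x : E} :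
    x ∈ limitSubspace X ↔ ∃ u : ℕ → E, (∀ n, u n ∈ X n) ∧ Tendsto u atTop (𝓝 x) :=
  Iff.rfl

/-- Every point of the closed unit ball of `limitSubspace X` is a limit of points of the closed
unit balls of the `X n`. -/
theorem exists_tendsto_of_mem_limitSubspace {X : ℕ → Subspace ℝ E} {x : E}
    (hx : x ∈ limitSubspace X) (hx1 : ‖x‖ ≤ 1) :
    ∃ u : ℕ → E, (∀ n, u n ∈ X n ∧ ‖u n‖ ≤ 1) ∧ Tendsto u atTop (𝓝 x) := by
  obtain ⟨u, hu, hux⟩ := hx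
  refine ⟨fun n => (max 1 ‖u n‖)⁻¹ • u n, fun n => ⟨(X n).smul_mem _ (hu n), ?_⟩, ?_⟩
  · have h : 0 < max 1 ‖u n‖ := lt_max_of_lt_left one_pos
    rw [norm_smul, norm_inv, Real.norm_of_nonneg h.le, inv_mul_le_iff₀ h, mul_one]
    exact le_max_right _ _
  · have h : Tendsto (fun n => (max 1 ‖u n‖)⁻¹ • u n) atTop (𝓝 ((max 1 ‖x‖)⁻¹ • x)) :=
      ((tendsto_const_nhds.max hux.norm).inv₀ (lt_max_of_lt_left one_pos).ne').smul hux
    simpa [max_eq_left hx1] using h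

theorem hausdorffEDist_unitBall_ne_top (Y : Subspace ℝ E) {A : Set E} (hAne : A.Nonempty)
    (hA : Bornology.IsBounded A) :
    Metric.hausdorffEDist {x : E | x ∈ Y ∧ ‖x‖ ≤ 1} A ≠ ⊤ := by
  refine Metric.hausdorffEDist_ne_top_of_nonempty_of_bounded ⟨0, Y.zero_mem, by simp⟩ hAne ?_ hA
  exact Metric.isBounded_closedBall.subset fun x hx => mem_closedBall_zero_iff.2 hx.2

/-- The Hausdorff limit of the closed unit balls of the `X n` is the closed unit ball of
`limitSubspace X`. -/
theorem eq_unitBall_limitSubspace {X : ℕ → Subspace ℝ E} {A : Set E} (hAne : A.Nonempty)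
    (hAcomp : IsCompact A)
    (hconv : Tendsto (fun n => Metric.hausdorffDist {x : E | x ∈ X n ∧ ‖x‖ ≤ 1} A)
      atTop (𝓝 0)) :
    A = {x : E | x ∈ limitSubspace X ∧ ‖x‖ ≤ 1} := by
  have hfin n := hausdorffEDist_unitBall_ne_top (X n) hAne hAcomp.isBounded
  ext a
  constructor
  · intro ha
    have hlt : ∀ n : ℕ, ∃ y ∈ {x : E | x ∈ X n ∧ ‖x‖ ≤ 1}, dist y a <
        Metric.hausdorffDist {x : E | x ∈ X n ∧ ‖x‖ ≤ 1} A + 1 / ((n : ℝ) + 1) := fun n =>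
      Metric.exists_dist_lt_of_hausdorffDist_lt' ha
        (lt_add_of_pos_right _ Nat.one_div_pos_of_nat) (hfin n)
    choose u hu hua using hlt
    have hlim : Tendsto u atTop (𝓝 a) := by
      rw [tendsto_iff_dist_tendsto_zero]
      refine squeeze_zero (fun _ => dist_nonneg) (fun n => (hua n).le) ?_
      simpa using hconv.add (tendsto_one_div_add_atTop_nhds_zero_nat (𝕜 := ℝ))
    exact ⟨⟨u, fun n => (hu n).1, hlim⟩,
      le_of_tendsto hlim.norm (Eventually.of_forall fun n => (hu n).2)⟩
  · rintro ⟨ha, ha1⟩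
    obtain ⟨u, hu, hua⟩ := exists_tendsto_of_mem_limitSubspace ha ha1
    rw [hAcomp.isClosed.mem_iff_infDist_zero hAne]
    have h : Tendsto (fun n => Metric.infDist (u n) A) atTop (𝓝 (Metric.infDist a A)) :=
      ((Metric.continuous_infDist_pt A).tendsto a).comp hua
    exact tendsto_nhds_unique h (squeeze_zero (fun _ => Metric.infDist_nonneg)
      (fun n => Metric.infDist_le_hausdorffDist_of_mem (hu n) (hfin n)) hconv)

/-- A subspace whose closed unit ball is compact is finite-dimensional. -/
theorem finiteDimensional_of_isCompact_unitBall (Y : Subspace ℝ E)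
    (h : IsCompact {x : E | x ∈ Y ∧ ‖x‖ ≤ 1}) : FiniteDimensional ℝ Y := by
  refine FiniteDimensional.of_isCompact_closedBall ℝ one_pos (c := (0 : Y)) ?_
  rw [Subtype.isCompact_iff]
  convert h using 1
  ext x
  simp [and_comm]

/-- If every `X n` has dimension `k`, then `limitSubspace X` has dimension at most `k`. -/
theorem finrank_limitSubspace_le {X : ℕ → Subspace ℝ E} {k : ℕ}
    (hfd : ∀ n, FiniteDimensional ℝ (X n)) (hk : ∀ n, finrank ℝ (X n) = k)
    [FiniteDimensional ℝ (limitSubspace X)] : finrank ℝ (limitSubspace X) ≤ k := by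
  let b := finBasis ℝ (limitSubspace X)
  choose u hu hlim using fun i => mem_limitSubspace.1 (b i).2
  have hli : LinearIndependent ℝ fun i => (b i : E) :=
    b.linearIndependent.map' (limitSubspace X).subtype (Submodule.ker_subtype _)
  have hev : ∀ᶠ n in atTop, LinearIndependent ℝ fun i => u i n :=
    (tendsto_pi_nhds.2 hlim).eventually (isOpen_setOfPred_linearIndependent.mem_nhds hli)
  obtain ⟨n, hn⟩ := hev.exists
  have hn' : LinearIndependent ℝ fun i => (⟨u i n, hu i n⟩ : X n) :=
    LinearIndependent.of_comp (X n).subtype hn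
  have := hfd n
  simpa [hk n] using hn'.fintype_card_le_finrank

/-- If the closed unit ball of `Y` is sufficiently close to a finite-dimensional subspace `Z`,
then the dimension of `Y` is at most that of `Z`. -/
theorem exists_pos_forall_finrank_le (Z : Subspace ℝ E) [FiniteDimensional ℝ Z] :
    ∃ ε > 0, ∀ Y : Subspace ℝ E, FiniteDimensional ℝ Y →
      (∀ y ∈ Y, ‖y‖ ≤ 1 → ∃ z ∈ Z, dist y z < ε) → finrank ℝ Y ≤ finrank ℝ Z := by
  obtain ⟨P, hP⟩ := Submodule.ClosedComplemented.of_finiteDimensional Z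
  refine ⟨(1 + ‖P‖)⁻¹, by positivity, fun Y _ hY => ?_⟩
  by_contra! hlt
  obtain ⟨y, hy, hy0⟩ := (Submodule.ne_bot_iff _).1
    (LinearMap.ker_ne_bot_of_finrank_lt (f := P.toLinearMap ∘ₗ Y.subtype) hlt)
  have hPy : P (y : E) = 0 := hy
  have hy0' : (y : E) ≠ 0 := by simpa using hy0
  have hnorm : ‖(‖(y : E)‖⁻¹ • (y : E))‖ = 1 := norm_smul_inv_norm (𝕜 := ℝ) hy0'
  obtain ⟨z, hz, hd⟩ := hY _ (Y.smul_mem ‖(y : E)‖⁻¹ y.2) hnorm.le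
  set w : E := ‖(y : E)‖⁻¹ • (y : E)
  have hPw : P w = 0 := by simp [w, hPy]
  have hzn : ‖z‖ ≤ ‖P‖ * ‖w - z‖ := by
    have h := P.le_opNorm (w - z)
    rwa [map_sub, hPw, hP ⟨z, hz⟩, zero_sub, norm_neg] at h
  have htri : ‖w‖ ≤ ‖w - z‖ + ‖z‖ := by simpa using norm_add_le (w - z) z
  rw [dist_eq_norm, ← one_div, lt_div_iff₀ (by positivity)] at hd
  linarith

end LimitSubspace

/-- If the closed unit balls of a sequence of `k`-dimensional subspaces of a real Banach space
converge in Hausdorff distance to a nonempty compact set `A`, then `A` is the closed unit ball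
of a `k`-dimensional subspace. -/
theorem limit_of_unit_balls_is_unit_ball
    (E : Type*) [NormedAddCommGroup E] [NormedSpace ℝ E] [CompleteSpace E]
    (k : ℕ) (X : ℕ → Subspace ℝ E)
    (hfd : ∀ n, FiniteDimensional ℝ (X n)) (hk : ∀ n, finrank ℝ (X n) = k)
    (A : Set E) (hAne : A.Nonempty) (hAcomp : IsCompact A)
    (hconv : Filter.Tendsto
      (fun n => Metric.hausdorffDist {x : E | x ∈ X n ∧ ‖x‖ ≤ 1} A)
      Filter.atTop (nhds 0)) :
    ∃ X₀ : Subspace ℝ E, FiniteDimensional ℝ X₀ ∧ finrank ℝ X₀ = k ∧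
      A = {x : E | x ∈ X₀ ∧ ‖x‖ ≤ 1} := by
  have hA := eq_unitBall_limitSubspace hAne hAcomp hconv
  have hfin : FiniteDimensional ℝ (limitSubspace X) :=
    finiteDimensional_of_isCompact_unitBall _ (hA ▸ hAcomp)
  refine ⟨limitSubspace X, hfin, (finrank_limitSubspace_le hfd hk).antisymm ?_, hA⟩
  obtain ⟨ε, hε, h⟩ := exists_pos_forall_finrank_le (limitSubspace X)
  obtain ⟨n, hn⟩ := (hconv.eventually_lt_const hε).exists
  rw [← hk n]
  refine h (X n) (hfd n) fun y hy hy1 => ?_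
  obtain ⟨z, hz, hyz⟩ := Metric.exists_dist_lt_of_hausdorffDist_lt
    (show y ∈ {x : E | x ∈ X n ∧ ‖x‖ ≤ 1} from ⟨hy, hy1⟩) hn
    (hausdorffEDist_unitBall_ne_top (X n) hAne hAcomp.isBounded)
  rw [hA] at hz
  exact ⟨z, hz.1, hyz⟩
end
end

section
/- Let E be a real Banach space, k ≥ 1, and let X, Y be k-dimensional subspaces of E. If d is a real number with d_H(B_X, B_Y) ≤ d < 1/(2k), then there exists a linear isomorphism λ : X → Y such that ‖λ‖ ≤ 1 + kd, ‖λ⁻¹‖ ≤ 1/(1 − kd), and ‖λx − x‖ ≤ kd·‖x‖ for all x ∈ X. -/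
noncomputable section

open Module

/-- **Auerbach's lemma**: a finite-dimensional real normed space has a basis of vectors of norm at
most one whose coordinate functionals have norm at most one. -/
theorem exists_auerbach_basis {V ι : Type*} [NormedAddCommGroup V] [NormedSpace ℝ V]
    [FiniteDimensional ℝ V] [Fintype ι] (b : Basis ι ℝ V) :
    ∃ e : Basis ι ℝ V, (∀ i, ‖e i‖ ≤ 1) ∧ ∀ i x, |e.repr x i| ≤ ‖x‖ := by
  classical
  have : ProperSpace V := FiniteDimensional.proper ℝ V
  have hcont : Continuous fun v : ι → V => |b.det v| := by
    have h : Continuous fun v : ι → V => (b.toMatrix v).det := by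
      refine Continuous.matrix_det (continuous_matrix fun i j => ?_)
      exact (LinearMap.continuous_of_finiteDimensional (b.coord i)).comp (continuous_apply j)
    simpa only [b.det_apply] using h.abs
  have hcompact : IsCompact (Set.univ.pi fun _ : ι => Metric.closedBall (0 : V) 1) :=
    isCompact_univ_pi fun _ => isCompact_closedBall 0 1
  obtain ⟨v, hv, hmax⟩ := hcompact.exists_isMaxOn ⟨0, by simp⟩ hcont.continuousOn
  simp only [Set.mem_pi, Set.mem_univ, mem_closedBall_zero_iff, true_implies] at hv
  replace hmax : ∀ w : ι → V, (∀ i, ‖w i‖ ≤ 1) → |b.det w| ≤ |b.det v| := fun w hw =>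
    hmax (by simpa using hw)
  have hne : b.det v ≠ 0 := by
    have hnorm : ∀ i, ‖b i‖ ≠ 0 := fun i => norm_ne_zero_iff.mpr (b.ne_zero i)
    have hu : ∀ i, IsUnit ‖b i‖⁻¹ := fun i => (inv_ne_zero (hnorm i)).isUnit
    have hle := hmax (b.isUnitSMul hu) fun i => by
      rw [Basis.isUnitSMul_apply, norm_smul, norm_inv, norm_norm, inv_mul_cancel₀ (hnorm i)]
    exact abs_pos.mp ((abs_pos.mpr (b.isUnit_det (b.isUnitSMul hu)).ne_zero).trans_le hle)
  obtain ⟨hli, hsp⟩ := b.is_basis_iff_det.mpr hne.isUnit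
  have hcoord : ∀ i x, ‖x‖ ≤ 1 → |(Basis.mk hli hsp.ge).repr x i| ≤ 1 := fun i x hx => by
    have hcramer : b.det v * (Basis.mk hli hsp.ge).repr x i = b.det (Function.update v i x) := by
      simpa using LinearMap.congr_fun (b.det_smul_mk_coord_eq_det_update hli hsp.ge i) x
    have hle := hmax (Function.update v i x) fun j => by
      rcases eq_or_ne j i with rfl | hj
      · simpa using hx
      · simpa [hj] using hv j
    rw [← hcramer, abs_mul] at hle
    exact (mul_le_iff_le_one_right (abs_pos.mpr hne)).mp hle
  refine ⟨Basis.mk hli hsp.ge, fun i => by simpa using hv i, fun i x => ?_⟩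
  rcases eq_or_ne x 0 with rfl | hx
  · rw [map_zero, Finsupp.zero_apply, abs_zero, norm_zero]
  · have hpos := norm_pos_iff.mpr hx
    have h := hcoord i (‖x‖⁻¹ • x) (by
      rw [norm_smul, norm_inv, norm_norm, inv_mul_cancel₀ hpos.ne'])
    rw [map_smul, Finsupp.smul_apply, smul_eq_mul, abs_mul, abs_inv, abs_norm,
      inv_mul_le_one₀ hpos] at h
    exact h

/-- If the Hausdorff distance from a unit ball to that of a finite-dimensional subspace `Y` is at
most `d`, then every vector of the first ball lies within `d` of a vector of the unit ball
of `Y`. -/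
theorem exists_norm_sub_le_of_hausdorffDist_le {E : Type*} [NormedAddCommGroup E] [NormedSpace ℝ E]
    {X Y : Subspace ℝ E} [FiniteDimensional ℝ Y] {d : ℝ}
    (hdH : Metric.hausdorffDist {x : E | x ∈ X ∧ ‖x‖ ≤ 1} {x : E | x ∈ Y ∧ ‖x‖ ≤ 1} ≤ d)
    {x : E} (hx : x ∈ X) (hx1 : ‖x‖ ≤ 1) : ∃ y ∈ Y, ‖y‖ ≤ 1 ∧ ‖y - x‖ ≤ d := by
  have : ProperSpace Y := FiniteDimensional.proper ℝ Y
  have hcompact : IsCompact {x : E | x ∈ Y ∧ ‖x‖ ≤ 1} := by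
    convert! (isCompact_closedBall (0 : Y) 1).image continuous_subtype_val
    ext z
    simp [and_comm]
  have hne (Z : Subspace ℝ E) : {x : E | x ∈ Z ∧ ‖x‖ ≤ 1}.Nonempty := ⟨0, by simp⟩
  have hbdd (Z : Subspace ℝ E) : Bornology.IsBounded {x : E | x ∈ Z ∧ ‖x‖ ≤ 1} :=
    Metric.isBounded_closedBall.subset fun z hz => mem_closedBall_zero_iff.mpr hz.2
  obtain ⟨y, hy, hxy⟩ := hcompact.exists_infDist_eq_dist (hne Y) x
  refine ⟨y, hy.1, hy.2, ?_⟩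
  rw [← dist_eq_norm, dist_comm, ← hxy]
  exact (Metric.infDist_le_hausdorffDist_of_mem (show x ∈ {x : E | x ∈ X ∧ ‖x‖ ≤ 1} from ⟨hx, hx1⟩)
    (Metric.hausdorffEDist_ne_top_of_nonempty_of_bounded (hne X) (hne Y) (hbdd X) (hbdd Y))).trans
    hdH

/-- If `X, Y` are `k`-dimensional subspaces of a real Banach space `E` whose unit balls are at
Hausdorff distance at most `d < 1/(2k)`, then there is a linear isomorphism `λ : X → Y` with
`‖λ‖ ≤ 1 + kd`, `‖λ⁻¹‖ ≤ 1/(1 − kd)` and `‖λx − x‖ ≤ kd‖x‖` for all `x ∈ X`. -/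
theorem isomorphism_of_close_unit_balls
    (E : Type*) [NormedAddCommGroup E] [NormedSpace ℝ E] [CompleteSpace E]
    (k : ℕ) (hk : 1 ≤ k) (X Y : Subspace ℝ E)
    [FiniteDimensional ℝ X] [FiniteDimensional ℝ Y]
    (hX : finrank ℝ X = k) (hY : finrank ℝ Y = k)
    (d : ℝ)
    (hdH : Metric.hausdorffDist {x : E | x ∈ X ∧ ‖x‖ ≤ 1} {x : E | x ∈ Y ∧ ‖x‖ ≤ 1} ≤ d)
    (hd : d < 1 / (2 * (k : ℝ))) :
    ∃ lam : X ≃L[ℝ] Y,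
      ‖(lam : X →L[ℝ] Y)‖ ≤ 1 + (k : ℝ) * d ∧
      ‖(lam.symm : Y →L[ℝ] X)‖ ≤ 1 / (1 - (k : ℝ) * d) ∧
      ∀ x : X, ‖(lam x : E) - (x : E)‖ ≤ (k : ℝ) * d * ‖x‖ := by
  have hd0 : 0 ≤ d := Metric.hausdorffDist_nonneg.trans hdH
  have hkpos : (0 : ℝ) < k := by exact_mod_cast hk
  have hkd0 : 0 ≤ (k : ℝ) * d := by positivity
  have hkd : (k : ℝ) * d < 1 := by
    rw [lt_div_iff₀ (by positivity)] at hd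
    linarith
  obtain ⟨e, he, hcoord⟩ := exists_auerbach_basis (finBasisOfFinrankEq ℝ X hX)
  choose y hyY _ hye using fun i =>
    exists_norm_sub_le_of_hausdorffDist_le hdH (e i).2 (he i)
  let f : X →ₗ[ℝ] Y := e.constr ℝ fun i => ⟨y i, hyY i⟩
  have hclose : ∀ x : X, ‖(f x : E) - (x : E)‖ ≤ (k : ℝ) * d * ‖x‖ := fun x => by
    have hsum : (f x : E) - (x : E) = ∑ i, e.repr x i • (y i - (e i : E)) := by
      have hx : (x : E) = ∑ i, e.repr x i • (e i : E) := by
        simpa only [map_sum, map_smul, Submodule.subtype_apply] using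
          congrArg X.subtype (e.sum_repr x).symm
      have hfx : (f x : E) = ∑ i, e.repr x i • y i := by
        simp [f, Basis.constr_apply_fintype]
      rw [hfx, hx]
      simp only [smul_sub, Finset.sum_sub_distrib, ← hx]
    calc ‖(f x : E) - (x : E)‖ ≤ ∑ i, ‖e.repr x i • (y i - (e i : E))‖ :=
          hsum ▸ norm_sum_le _ _
      _ ≤ ∑ _i : Fin k, ‖x‖ * d := by
          refine Finset.sum_le_sum fun i _ => ?_
          rw [norm_smul, Real.norm_eq_abs]
          exact mul_le_mul (hcoord i x) (hye i) (norm_nonneg _) (norm_nonneg _)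
      _ = (k : ℝ) * d * ‖x‖ := by
          rw [Finset.sum_const, Finset.card_univ, Fintype.card_fin, nsmul_eq_mul]
          ring
  have hupper : ∀ x : X, ‖f x‖ ≤ (1 + (k : ℝ) * d) * ‖x‖ := fun x => by
    have h := norm_le_norm_add_norm_sub' (f x : E) (x : E)
    have h' := hclose x
    rw [Submodule.coe_norm, Submodule.coe_norm] at *
    linarith
  have hlower : ∀ x : X, (1 - (k : ℝ) * d) * ‖x‖ ≤ ‖f x‖ := fun x => by
    have h := norm_le_norm_add_norm_sub' (x : E) (f x : E)
    have h' := hclose x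
    rw [norm_sub_rev] at h
    rw [Submodule.coe_norm, Submodule.coe_norm] at *
    linarith
  have hinj : Function.Injective f := (injective_iff_map_eq_zero f).mpr fun x hx => by
    have h := hlower x
    rw [hx, norm_zero] at h
    exact norm_le_zero_iff.mp (nonpos_of_mul_nonpos_right h (by linarith))
  refine ⟨(f.linearEquivOfInjective hinj (hX.trans hY.symm)).toContinuousLinearEquiv, ?_, ?_, hclose⟩
  · exact ContinuousLinearMap.opNorm_le_bound _ (by linarith) hupper
  · refine ContinuousLinearMap.opNorm_le_bound _ (by
      have : 0 < 1 - (k : ℝ) * d := by linarith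
      positivity) fun z => ?_
    obtain ⟨x, rfl⟩ :=
      (f.linearEquivOfInjective hinj (hX.trans hY.symm)).toContinuousLinearEquiv.surjective z
    rw [ContinuousLinearEquiv.coe_coe, ContinuousLinearEquiv.symm_apply_apply, one_div,
      le_inv_mul_iff₀ (by linarith)]
    exact hlower x
end
end

section
/- Let E be a real Banach space, k ≥ 1, and let X, Y be k-dimensional subspaces of E. If δ is a real number with D_E^a(X,Y) < δ < 1/(2k²), then there exists a linear isomorphism T : E → E (a bounded linear bijection with bounded inverse) such that T(X) = Y and ‖T‖·‖T⁻¹‖ ≤ (1+δ)²·(1+k²δ)/(1−k²δ). -/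
noncomputable section

open Module

/-- The closed unit ball of a subspace `X` of `E`, viewed as a subset of `E`. -/
def ballSet {E : Type*} [NormedAddCommGroup E] [NormedSpace ℝ E]
    (X : Subspace ℝ E) : Set E :=
  {x : E | x ∈ X ∧ ‖x‖ ≤ 1}

/-- `D_δ(X,Y) = inf { d_H(T(B_X), U(B_Y)) : T, U ∈ Isom_δ(E) }`. -/
def DDelta {E : Type*} [NormedAddCommGroup E] [NormedSpace ℝ E]
    (δ : ℝ) (X Y : Subspace ℝ E) : ℝ :=
  sInf {r : ℝ | ∃ T U : E ≃L[ℝ] E, IsEpsIsom δ T ∧ IsEpsIsom δ U ∧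
    r = Metric.hausdorffDist ((fun z => T z) '' ballSet X) ((fun z => U z) '' ballSet Y)}

/-- `D_E^a(X,Y) = sup_{δ > 0} D_δ(X,Y)`. -/
def DistDA {E : Type*} [NormedAddCommGroup E] [NormedSpace ℝ E]
    (X Y : Subspace ℝ E) : ℝ :=
  ⨆ δ : Set.Ioi (0 : ℝ), DDelta (δ : ℝ) X Y

/-- Auerbach's lemma: a finite-dimensional normed space has a basis of vectors of norm at most one
whose coordinate functionals have norm at most one. -/
theorem exists_auerbach_basis_s18 (V : Type*) [NormedAddCommGroup V] [NormedSpace ℝ V]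
    [FiniteDimensional ℝ V] {k : ℕ} (hV : finrank ℝ V = k) :
    ∃ v : Basis (Fin k) ℝ V, (∀ i, ‖v i‖ ≤ 1) ∧ ∀ i z, |v.coord i z| ≤ ‖z‖ := by
  have : ProperSpace V := FiniteDimensional.proper ℝ V
  let b : Basis (Fin k) ℝ V := finBasisOfFinrankEq ℝ V hV
  let K : Set (Fin k → V) := Set.pi Set.univ fun _ => Metric.closedBall 0 1
  have hK : IsCompact K := isCompact_univ_pi fun _ => isCompact_closedBall 0 1
  have hcont : Continuous fun v : Fin k → V => |b.det v| := by
    refine continuous_abs.comp ?_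
    change Continuous fun v : Fin k → V => (b.toMatrix v).det
    refine Continuous.matrix_det (continuous_matrix fun i j => ?_)
    exact (LinearMap.continuous_of_finiteDimensional (b.coord i)).comp (continuous_apply j)
  obtain ⟨v, hvK, hmax⟩ := hK.exists_isMaxOn ⟨0, by simp [K]⟩ hcont.continuousOn
  have hv : ∀ i, ‖v i‖ ≤ 1 := fun i => by simpa using hvK i (Set.mem_univ i)
  have hpos : 0 < |b.det v| := by
    have hmem : (fun i => ‖b i‖⁻¹ • b i) ∈ K := fun i _ => by
      simp [norm_smul, inv_mul_cancel₀ (norm_ne_zero_iff.2 (b.ne_zero i))]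
    refine lt_of_lt_of_le ?_ (hmax hmem)
    have hdet : b.det (fun i => ‖b i‖⁻¹ • b i) = (∏ i, ‖b i‖⁻¹) * b.det b := by
      simpa using b.det.map_smul_univ (fun i => ‖b i‖⁻¹) b
    simp only [hdet, Basis.det_self, mul_one, abs_pos]
    exact Finset.prod_ne_zero_iff.2 fun i _ => inv_ne_zero (norm_ne_zero_iff.2 (b.ne_zero i))
  obtain ⟨hli, hsp⟩ := (Module.Basis.is_basis_iff_det b).2 (isUnit_iff_ne_zero.2 (abs_pos.1 hpos))
  refine ⟨Basis.mk hli hsp.ge, fun i => by simpa using hv i, fun i z => ?_⟩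
  have hcoord : ∀ z, b.det v * (Basis.mk hli hsp.ge).coord i z =
      b.det (Function.update v i z) := fun z => by
    simpa using LinearMap.congr_fun (b.det_smul_mk_coord_eq_det_update hli hsp.ge i) z
  have hball : ∀ z : V, ‖z‖ ≤ 1 → |(Basis.mk hli hsp.ge).coord i z| ≤ 1 := fun z hz => by
    have hmem : Function.update v i z ∈ K := fun j _ => by
      by_cases hj : j = i
      · subst hj; simpa using hz
      · simpa [hj] using hv j
    have hle : |b.det (Function.update v i z)| ≤ |b.det v| := hmax hmem
    rw [← hcoord, abs_mul] at hle
    exact le_of_mul_le_mul_left (by simpa using hle) hpos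
  by_cases hz : z = 0
  · rw [hz, map_zero, abs_zero, norm_zero]
  have hz' : 0 < ‖z‖ := norm_pos_iff.2 hz
  have h := hball (‖z‖⁻¹ • z) (by simp [norm_smul, inv_mul_cancel₀ hz'.ne'])
  rw [map_smul, smul_eq_mul, abs_mul, abs_inv, abs_norm, inv_mul_le_iff₀ hz', mul_one] at h
  exact h

section

variable {E : Type*} [NormedAddCommGroup E] [NormedSpace ℝ E]

/-- The coordinate functionals of an Auerbach basis, extended to the ambient space. -/
theorem exists_auerbach_system (X : Subspace ℝ E) [FiniteDimensional ℝ X] {k : ℕ}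
    (hX : finrank ℝ X = k) :
    ∃ (x : Fin k → E) (f : Fin k → StrongDual ℝ E), (∀ i, x i ∈ ballSet X) ∧
      (∀ i, ‖f i‖ ≤ 1) ∧ ∀ z ∈ X, z = ∑ i, f i z • x i := by
  obtain ⟨v, hv, hcoord⟩ := exists_auerbach_basis_s18 X hX
  have hext : ∀ i, ∃ g : StrongDual ℝ E, (∀ z : X, g z = v.coord i z) ∧ ‖g‖ ≤ 1 := fun i => by
    let c : StrongDual ℝ X := (v.coord i).mkContinuous 1 (by simpa using hcoord i)
    obtain ⟨g, hg, hgn⟩ := exists_extension_norm_eq X c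
    exact ⟨g, hg, hgn ▸ LinearMap.mkContinuous_norm_le _ zero_le_one _⟩
  choose f hf hfn using hext
  refine ⟨fun i => v i, f, fun i => ⟨(v i).2, hv i⟩, hfn, fun z hz => ?_⟩
  have h := congrArg (X.subtype) (v.sum_repr ⟨z, hz⟩)
  rw [map_sum] at h
  refine h.symm.trans (Finset.sum_congr rfl fun i _ => ?_)
  simp [hf i ⟨z, hz⟩]

theorem isEpsIsom_refl {ε : ℝ} (hε : 0 ≤ ε) : IsEpsIsom ε (ContinuousLinearEquiv.refl ℝ E) :=
  fun z => ⟨mul_le_of_le_one_left (norm_nonneg z) (inv_le_one_of_one_le₀ (by linarith)),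
    le_mul_of_one_le_left (norm_nonneg z) (by linarith)⟩

theorem DDelta_nonneg (ε : ℝ) (X Y : Subspace ℝ E) : 0 ≤ DDelta ε X Y := by
  refine Real.sInf_nonneg ?_
  rintro r ⟨T, U, -, -, rfl⟩
  exact Metric.hausdorffDist_nonneg

theorem DDelta_le_hausdorffDist {ε : ℝ} (hε : 0 ≤ ε) (X Y : Subspace ℝ E) :
    DDelta ε X Y ≤ Metric.hausdorffDist (ballSet X) (ballSet Y) := by
  refine csInf_le ⟨0, ?_⟩ ⟨_, _, isEpsIsom_refl hε, isEpsIsom_refl hε, by simp⟩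
  rintro r ⟨T, U, -, -, rfl⟩
  exact Metric.hausdorffDist_nonneg

theorem DDelta_le_DistDA {ε : ℝ} (hε : 0 < ε) (X Y : Subspace ℝ E) :
    DDelta ε X Y ≤ DistDA X Y := by
  refine le_ciSup (f := fun δ : Set.Ioi (0 : ℝ) => DDelta (δ : ℝ) X Y)
    ⟨Metric.hausdorffDist (ballSet X) (ballSet Y), ?_⟩ ⟨ε, hε⟩
  rintro _ ⟨δ, rfl⟩
  exact DDelta_le_hausdorffDist (le_of_lt δ.2) X Y

theorem DistDA_nonneg (X Y : Subspace ℝ E) : 0 ≤ DistDA X Y :=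
  (DDelta_nonneg 1 X Y).trans (DDelta_le_DistDA one_pos X Y)

theorem image_ballSet_nonempty (X : Subspace ℝ E) (T : E ≃L[ℝ] E) :
    ((fun z => T z) '' ballSet X).Nonempty :=
  ⟨_, 0, ⟨X.zero_mem, by simp⟩, rfl⟩

theorem image_ballSet_isBounded (X : Subspace ℝ E) (T : E ≃L[ℝ] E) :
    Bornology.IsBounded ((fun z => T z) '' ballSet X) := by
  refine isBounded_iff_forall_norm_le.2 ⟨‖(T : E →L[ℝ] E)‖, ?_⟩
  rintro _ ⟨z, hz, rfl⟩
  exact (T : E →L[ℝ] E).unit_le_opNorm z hz.2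

theorem exists_isEpsIsom_of_DistDA_lt {X Y : Subspace ℝ E} {ε m : ℝ} (hε : 0 < ε)
    (h : DistDA X Y < m) :
    ∃ T U : E ≃L[ℝ] E, IsEpsIsom ε T ∧ IsEpsIsom ε U ∧
      ∀ x ∈ ballSet X, ∃ y ∈ ballSet Y, ‖U y - T x‖ ≤ m := by
  obtain ⟨_, ⟨T, U, hT, hU, rfl⟩, hlt⟩ := exists_lt_of_csInf_lt
    (by exact ⟨_, _, _, isEpsIsom_refl hε.le, isEpsIsom_refl hε.le, rfl⟩)
    ((DDelta_le_DistDA hε X Y).trans_lt h)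
  refine ⟨T, U, hT, hU, fun x hx => ?_⟩
  obtain ⟨_, ⟨y, hy, rfl⟩, hd⟩ := Metric.exists_dist_lt_of_hausdorffDist_lt
    (Set.mem_image_of_mem (fun z => T z) hx) hlt
    (Metric.hausdorffEDist_ne_top_of_nonempty_of_bounded (image_ballSet_nonempty X T)
      (image_ballSet_nonempty Y U) (image_ballSet_isBounded X T) (image_ballSet_isBounded Y U))
  exact ⟨y, hy, by rw [← dist_eq_norm, dist_comm]; exact hd.le⟩

theorem IsEpsIsom.norm_le {ε : ℝ} {T : E ≃L[ℝ] E} (hT : IsEpsIsom ε T) (hε : 0 ≤ ε) :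
    ‖(T : E →L[ℝ] E)‖ ≤ 1 + ε :=
  ContinuousLinearMap.opNorm_le_bound _ (by linarith) fun z => (hT z).2

theorem IsEpsIsom.norm_symm_le {ε : ℝ} {T : E ≃L[ℝ] E} (hT : IsEpsIsom ε T) (hε : 0 ≤ ε) :
    ‖(T.symm : E →L[ℝ] E)‖ ≤ 1 + ε :=
  ContinuousLinearMap.opNorm_le_bound _ (by linarith) fun z => by
    have h := (hT (T.symm z)).1
    rwa [T.apply_symm_apply, inv_mul_le_iff₀ (by linarith)] at h

/-- A bounded perturbation of the identity of norm `a < 1` is an isomorphism. -/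
theorem exists_continuousLinearEquiv_one_add [CompleteSpace E] (R : E →L[ℝ] E) {a : ℝ}
    (hR : ‖R‖ ≤ a) (ha : a < 1) :
    ∃ S : E ≃L[ℝ] E, (∀ z, S z = z + R z) ∧ ‖(S : E →L[ℝ] E)‖ ≤ 1 + a ∧
      ‖(S.symm : E →L[ℝ] E)‖ ≤ 1 / (1 - a) := by
  have ha0 : 0 ≤ a := (norm_nonneg R).trans hR
  have hRz : ∀ z, ‖R z‖ ≤ a * ‖z‖ := R.le_of_opNorm_le hR
  let S : E ≃L[ℝ] E := ContinuousLinearEquiv.unitsEquiv ℝ E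
    (Units.oneSub (-R) (by rw [norm_neg]; exact hR.trans_lt ha))
  have hS : ∀ z, S z = z + R z := fun z => by simp [S]
  refine ⟨S, hS, ContinuousLinearMap.opNorm_le_bound _ (by linarith) fun z => ?_,
    ContinuousLinearMap.opNorm_le_bound _ (by have := sub_pos.2 ha; positivity) fun z => ?_⟩
  · have h1 := norm_add_le z (R z)
    have h2 := hRz z
    simp only [ContinuousLinearEquiv.coe_coe, hS]
    linarith
  · set w := S.symm z with hw
    have hz : z = w + R w := by rw [← hS, hw, S.apply_symm_apply]
    have h1 : ‖w‖ ≤ ‖z‖ + ‖R w‖ := by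
      have h := norm_sub_le z (R w)
      rwa [hz, add_sub_cancel_right, ← hz] at h
    have h2 := hRz w
    rw [ContinuousLinearEquiv.coe_coe, ← hw, one_div, ← div_eq_inv_mul,
      le_div_iff₀ (sub_pos.2 ha)]
    linarith

end

theorem exists_pos_sq_le_and_mul_le {δ m : ℝ} (hδ : 0 < δ) (hm : m < δ) :
    ∃ ε : ℝ, 0 < ε ∧ (1 + ε) ^ 2 ≤ 1 + δ ∧ (1 + ε) * m ≤ δ := by
  have h1 : ∀ᶠ ε : ℝ in nhdsWithin 0 (Set.Ioi 0), (1 + ε) ^ 2 < 1 + δ :=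
    nhdsWithin_le_nhds (ContinuousAt.eventually_lt (by fun_prop) (by fun_prop) (by simpa))
  have h2 : ∀ᶠ ε : ℝ in nhdsWithin 0 (Set.Ioi 0), (1 + ε) * m < δ :=
    nhdsWithin_le_nhds (ContinuousAt.eventually_lt (by fun_prop) (by fun_prop) (by simpa))
  obtain ⟨ε, ⟨h1, h2⟩, hε⟩ := ((h1.and h2).and self_mem_nhdsWithin).exists
  exact ⟨ε, hε, h1.le, h2.le⟩

/-- If `X, Y` are `k`-dimensional subspaces of a real Banach space `E` with
`D_E^a(X,Y) < δ < 1/(2k²)`, then there is a linear isomorphism `T` of `E` with `T(X) = Y` and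
`‖T‖·‖T⁻¹‖ ≤ (1+δ)²(1+k²δ)/(1−k²δ)`. -/
theorem global_isomorphism_of_small_DistDA
    (E : Type*) [NormedAddCommGroup E] [NormedSpace ℝ E] [CompleteSpace E]
    (k : ℕ) (hk : 1 ≤ k) (X Y : Subspace ℝ E)
    [FiniteDimensional ℝ X] [FiniteDimensional ℝ Y]
    (hX : finrank ℝ X = k) (hY : finrank ℝ Y = k)
    (δ : ℝ) (hδ₁ : DistDA X Y < δ) (hδ₂ : δ < 1 / (2 * (k : ℝ) ^ 2)) :
    ∃ T : E ≃L[ℝ] E,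
      Submodule.map ((T : E →L[ℝ] E) : E →ₗ[ℝ] E) X = Y ∧
      ‖(T : E →L[ℝ] E)‖ * ‖(T.symm : E →L[ℝ] E)‖ ≤
        (1 + δ) ^ 2 * (1 + (k : ℝ) ^ 2 * δ) / (1 - (k : ℝ) ^ 2 * δ) := by
  have hδ : 0 < δ := (DistDA_nonneg X Y).trans_lt hδ₁
  have hk' : (1 : ℝ) ≤ k := by exact_mod_cast hk
  have ha : (k : ℝ) ^ 2 * δ < 1 := by
    rw [lt_div_iff₀ (by positivity)] at hδ₂
    linarith
  obtain ⟨m, hm, hmδ⟩ := exists_between hδ₁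
  obtain ⟨ε, hε, hε2, hεm⟩ := exists_pos_sq_le_and_mul_le hδ hmδ
  obtain ⟨A, U, hA, hU, hAU⟩ := exists_isEpsIsom_of_DistDA_lt hε hm
  obtain ⟨x, f, hx, hf, hsum⟩ := exists_auerbach_system X hX
  choose y hy hxy using fun i => hAU (x i) (hx i)
  let R : E →L[ℝ] E :=
    ∑ i, ((f i).comp (A.symm : E →L[ℝ] E)).smulRight (U (y i) - A (x i))
  have hR : ‖R‖ ≤ (k : ℝ) ^ 2 * δ := by
    have hterm : ∀ i ∈ (Finset.univ : Finset (Fin k)),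
        ‖((f i).comp (A.symm : E →L[ℝ] E)).smulRight (U (y i) - A (x i))‖ ≤ δ := fun i _ => by
      rw [ContinuousLinearMap.norm_smulRight_apply]
      have h1 : ‖(f i).comp (A.symm : E →L[ℝ] E)‖ ≤ 1 + ε :=
        ((f i).opNorm_comp_le _).trans <| by
          simpa using mul_le_mul (hf i) (hA.norm_symm_le hε.le) (norm_nonneg _) zero_le_one
      exact (mul_le_mul h1 (hxy i) (norm_nonneg _) (by linarith)).trans hεm
    have h := norm_sum_le_of_le _ hterm
    simp only [Finset.sum_const, Finset.card_univ, Fintype.card_fin, nsmul_eq_mul] at h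
    exact h.trans (mul_le_mul_of_nonneg_right (by nlinarith) hδ.le)
  obtain ⟨S, hS, hSn, hSn'⟩ := exists_continuousLinearEquiv_one_add R hR ha
  let T : E ≃L[ℝ] E := (A.trans S).trans U.symm
  have hT : ∀ z ∈ X, T z = ∑ i, f i z • y i := fun z hz => by
    have hAz : A z = ∑ i, f i z • A (x i) := by
      conv_lhs => rw [hsum z hz]
      simp
    have hSA : S (A z) = U (∑ i, f i z • y i) := by
      rw [hS]
      simp [R, smul_sub, Finset.sum_sub_distrib, ← hAz]
    simp [T, hSA]
  have hle : Submodule.map ((T : E →L[ℝ] E) : E →ₗ[ℝ] E) X ≤ Y := by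
    rintro _ ⟨z, hz, rfl⟩
    change T z ∈ Y
    rw [hT z hz]
    exact Y.sum_mem fun i _ => Y.smul_mem _ (hy i).1
  refine ⟨T, Submodule.eq_of_le_of_finrank_eq hle ?_, ?_⟩
  · rw [hY, ← hX]
    exact LinearEquiv.finrank_map_eq T.toLinearEquiv X
  have h1 : ‖(T : E →L[ℝ] E)‖ ≤ (1 + ε) * ((1 + (k : ℝ) ^ 2 * δ) * (1 + ε)) := by
    change ‖(U.symm : E →L[ℝ] E).comp ((S : E →L[ℝ] E).comp (A : E →L[ℝ] E))‖ ≤ _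
    refine (ContinuousLinearMap.opNorm_comp_le _ _).trans ?_
    gcongr
    · exact hU.norm_symm_le hε.le
    · refine (ContinuousLinearMap.opNorm_comp_le _ _).trans ?_
      gcongr
      exact hA.norm_le hε.le
  have h2 : ‖(T.symm : E →L[ℝ] E)‖ ≤ (1 + ε) * (1 / (1 - (k : ℝ) ^ 2 * δ) * (1 + ε)) := by
    change ‖(A.symm : E →L[ℝ] E).comp ((S.symm : E →L[ℝ] E).comp (U : E →L[ℝ] E))‖ ≤ _
    have hpos := sub_pos.2 ha
    refine (ContinuousLinearMap.opNorm_comp_le _ _).trans ?_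
    gcongr
    · exact hA.norm_symm_le hε.le
    · refine (ContinuousLinearMap.opNorm_comp_le _ _).trans ?_
      gcongr
      exact hU.norm_le hε.le
  have hpos := sub_pos.2 ha
  calc ‖(T : E →L[ℝ] E)‖ * ‖(T.symm : E →L[ℝ] E)‖
      ≤ ((1 + ε) * ((1 + (k : ℝ) ^ 2 * δ) * (1 + ε))) *
        ((1 + ε) * (1 / (1 - (k : ℝ) ^ 2 * δ) * (1 + ε))) := by gcongr
    _ = ((1 + ε) ^ 2) ^ 2 * (1 + (k : ℝ) ^ 2 * δ) / (1 - (k : ℝ) ^ 2 * δ) := by ring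
    _ ≤ (1 + δ) ^ 2 * (1 + (k : ℝ) ^ 2 * δ) / (1 - (k : ℝ) ^ 2 * δ) := by gcongr
end
end
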